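/- arXiv:1104.5412 — 2 statements merged into one kernel-verified Lean document; each statement's English description precedes it below -/
import Mathlib

section
/- The spectrum of the bounded self-adjoint operator h_∞ on ℓ²(ℕ) equals the closed interval [−2t_L, 2t_L]. -/
/-- The complex Hilbert space `ℓ²(ℕ)`. -/
noncomputable abbrev L2N : Type := lp (fun _ : ℕ => ℂ) 2

theorem halfline_aux_norm
    (tL : ℝ) (htL : 0 < tL)
    (h : L2N →L[ℂ] L2N)
    (h0 : ∀ ψ : L2N, (h ψ) 0 = (tL : ℂ) * ψ 1)
    (hj : ∀ ψ : L2N, ∀ j : ℕ, (h ψ) (j + 1) = (tL : ℂ) * (ψ (j + 2) + ψ j)) :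
    ‖h‖ ≤ 2 * tL := by
  have key : ∀ φ : L2N, HasSum (fun j => ‖φ j‖ ^ 2) (‖φ‖ ^ 2) := by
    intro φ
    have := lp.hasSum_norm (p := 2) (by norm_num) φ
    simpa using this
  refine h.opNorm_le_bound (by positivity) fun ψ => ?_
  refine le_of_sq_le_sq ?_ (by positivity)
  have A := key ψ
  have B := key (h ψ)
  have A1 := (hasSum_nat_add_iff' 2).2 A
  have B1 := (hasSum_nat_add_iff' 1).2 B
  have C := (A1.add A).mul_left (2 * tL ^ 2)
  have D := hasSum_le (fun j => ?_) B1 C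
  · simp only [Finset.sum_range_succ, Finset.sum_range_zero, h0, norm_mul, Complex.norm_real,
      Real.norm_eq_abs, mul_pow, sq_abs] at D
    nlinarith [mul_nonneg (sq_nonneg tL) (sq_nonneg ‖ψ 0‖),
      mul_nonneg (sq_nonneg tL) (sq_nonneg ‖ψ 1‖)]
  · simp only [hj, norm_mul, Complex.norm_real, Real.norm_eq_abs, mul_pow, sq_abs]
    have h1 := norm_add_le (ψ (j + 2)) (ψ j)
    have h2 : ‖ψ (j + 2) + ψ j‖ ^ 2 ≤ 2 * (‖ψ (j + 2)‖ ^ 2 + ‖ψ j‖ ^ 2) := by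
      nlinarith [norm_nonneg (ψ (j + 2) + ψ j), sq_nonneg (‖ψ (j + 2)‖ - ‖ψ j‖)]
    nlinarith [mul_le_mul_of_nonneg_left h2 (sq_nonneg tL)]

theorem halfline_aux_rec (x : ℝ) (hx : |x| < 2) (r : ℕ → ℝ)
    (hr : Filter.Tendsto r Filter.atTop (nhds 0))
    (h1 : r 1 = x * r 0 + 1) (hrec : ∀ j, r (j + 2) = x * r (j + 1) - r j) : False := by
  have hc : ∀ j, r (j + 1) ^ 2 + r j ^ 2 - x * r j * r (j + 1) = x * r 0 + 1 + r 0 ^ 2 := by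
    intro j
    induction j with
    | zero => simp only [zero_add, h1]; ring
    | succ j ih => rw [← ih, hrec]; ring
  have hr' := (Filter.tendsto_add_atTop_iff_nat 1).2 hr
  have ht := ((hr'.pow 2).add (hr.pow 2)).sub ((hr.const_mul x).mul hr')
  simp only [hc] at ht
  have := tendsto_nhds_unique ht tendsto_const_nhds
  rw [abs_lt] at hx
  nlinarith [sq_nonneg (r 0 + x / 2)]

theorem halfline_aux_mem
    (tL : ℝ) (htL : 0 < tL)
    (h : L2N →L[ℂ] L2N)
    (h0 : ∀ ψ : L2N, (h ψ) 0 = (tL : ℂ) * ψ 1)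
    (hj : ∀ ψ : L2N, ∀ j : ℕ, (h ψ) (j + 1) = (tL : ℂ) * (ψ (j + 2) + ψ j))
    (x : ℝ) (hx : |x| < 2) : ((tL * x : ℝ) : ℂ) ∈ spectrum ℂ h := by
  intro hu
  obtain ⟨⟨u, v, huv, hvu⟩, hu'⟩ := hu
  simp only at hu'
  subst hu'
  let e : L2N := lp.single 2 0 (-(tL : ℂ))
  have he := congrArg (fun T : L2N →L[ℂ] L2N => T e) huv
  simp only [mul_apply_eq_comp, one_apply_eq_self] at he
  generalize v e = ψ at he
  have hco : ∀ j, ((tL * x : ℝ) : ℂ) * ψ j - (h ψ) j = e j := by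
    intro j
    rw [← he]
    simp [Algebra.algebraMap_eq_smul_one]
    rfl
  have hs : Summable (fun j => ‖ψ j‖ ^ 2) := by
    have := lp.hasSum_norm (p := 2) (by norm_num) ψ
    simpa using this.summable
  have hn : Filter.Tendsto (fun j => ‖ψ j‖) Filter.atTop (nhds 0) := by
    have := hs.tendsto_atTop_zero.sqrt
    simpa using this
  have hr : Filter.Tendsto (fun j => (ψ j).re) Filter.atTop (nhds 0) :=
    squeeze_zero_norm (fun j => Complex.abs_re_le_norm _) hn
  refine halfline_aux_rec x hx _ hr ?_ ?_
  · have := congrArg Complex.re (hco 0)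
    rw [h0] at this
    simp [e] at this
    apply mul_left_cancel₀ htL.ne'
    linarith
  · intro j
    have := congrArg Complex.re (hco (j + 1))
    rw [hj] at this
    simp [e] at this
    apply mul_left_cancel₀ htL.ne'
    linarith

theorem spectrum_of_halfline_laplacian
    (tL : ℝ) (htL : 0 < tL)
    (h : L2N →L[ℂ] L2N) (hsa : IsSelfAdjoint h)
    (h0 : ∀ ψ : L2N, (h ψ) 0 = (tL : ℂ) * ψ 1)
    (hj : ∀ ψ : L2N, ∀ j : ℕ, (h ψ) (j + 1) = (tL : ℂ) * (ψ (j + 2) + ψ j)) :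
    spectrum ℂ h = Complex.ofReal '' Set.Icc (-(2 * tL)) (2 * tL) := by
  apply Set.Subset.antisymm
  · intro z hz
    have hre := hsa.mem_spectrum_eq_re hz
    have hle : ‖z‖ ≤ 2 * tL := by
      have h1 := spectrum.norm_le_norm_mul_of_mem hz
      have h2 : ‖(1 : L2N →L[ℂ] L2N)‖ ≤ 1 := ContinuousLinearMap.norm_id_le
      have h3 := halfline_aux_norm tL htL h h0 hj
      nlinarith [norm_nonneg h]
    exact ⟨z.re, abs_le.1 ((Complex.abs_re_le_norm z).trans hle), hre.symm⟩
  · rintro _ ⟨y, hy, rfl⟩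
    have hcl : IsClosed (Complex.ofReal ⁻¹' spectrum ℂ h) :=
      (spectrum.isClosed h).preimage Complex.continuous_ofReal
    have hsub : Set.Ioo (-(2 * tL)) (2 * tL) ⊆ Complex.ofReal ⁻¹' spectrum ℂ h := by
      intro y hy
      have := halfline_aux_mem tL htL h h0 hj (y / tL) (by
        rw [abs_div, abs_of_pos htL, div_lt_iff₀ htL, abs_lt]
        exact hy)
      rwa [mul_div_cancel₀ _ htL.ne'] at this
    have := closure_minimal hsub hcl
    rw [closure_Ioo (by linarith)] at this
    exact this hy
end

section
/- Let t_L > 0, let e ∈ (−2t_L, 2t_L), let g : ℝ → ℝ be continuous, and let w : ℝ → ℝ be continuous with w(e) > 0. Then lim_{s→0⁺} s·∫_{−2t_L}^{2t_L} g(E)/((E − e)² + s²·w(E)²) dE = π·g(e)/w(e). -/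
open Real Filter MeasureTheory

theorem weighted_lorentzian_approximates_delta
    (tL : ℝ) (htL : 0 < tL) (e : ℝ) (he : e ∈ Set.Ioo (-(2 * tL)) (2 * tL))
    (g w : ℝ → ℝ) (hg : Continuous g) (hw : Continuous w) (hwe : 0 < w e) :
    Tendsto (fun s : ℝ => s * ∫ E in (-(2 * tL))..(2 * tL),
        g E / ((E - e) ^ 2 + s ^ 2 * w E ^ 2))
      (nhdsWithin 0 (Set.Ioi 0)) (nhds (π * g e / w e)) := by
  obtain ⟨hae, heb⟩ := he
  generalize -(2 * tL) = a at *
  generalize 2 * tL = b at *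
  obtain ⟨M, hM⟩ := (isCompact_Icc (a := a) (b := b)).exists_bound_of_continuousOn hg.continuousOn
  have hM0 : 0 ≤ M := (norm_nonneg _).trans (hM e ⟨hae.le, heb.le⟩)
  obtain ⟨δ, hδ, hδw⟩ : ∃ δ > 0, ∀ y, |y - e| < δ → w e / 2 < w y := by
    have h := hw.continuousAt.eventually (lt_mem_nhds (half_lt_self hwe))
    obtain ⟨δ, hδ, h⟩ := Metric.eventually_nhds_iff.1 h
    exact ⟨δ, hδ, fun y hy => h (by rwa [Real.dist_eq])⟩
  set W := w e with hW
  let G : ℝ → ℝ → ℝ := fun s x => W * (g (e + s * W * x) / ((W * x) ^ 2 + w (e + s * W * x) ^ 2))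
  let F : ℝ → ℝ → ℝ := fun s => (Set.Ioc ((a - e) / (s * W)) ((b - e) / (s * W))).indicator (G s)
  have hlimval : ∫ x : ℝ, (g e / W) * (1 + x ^ 2)⁻¹ = π * g e / W := by
    rw [integral_const_mul, integral_univ_inv_one_add_sq]; ring
  rw [← hlimval]
  have key : Tendsto (fun s => ∫ x, F s x) (nhdsWithin 0 (Set.Ioi 0))
      (nhds (∫ x : ℝ, (g e / W) * (1 + x ^ 2)⁻¹)) := by
    apply tendsto_integral_filter_of_dominated_convergence
      (fun x => (W * (M / (W ^ 2 / 4))) * (1 + x ^ 2)⁻¹)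
    · refine Eventually.of_forall fun s => ?_
      apply Measurable.aestronglyMeasurable
      apply Measurable.indicator _ measurableSet_Ioc
      have := hg.measurable
      have := hw.measurable
      fun_prop
    · have h1 : ∀ᶠ s in nhdsWithin (0 : ℝ) (Set.Ioi 0), s < δ / W :=
        nhdsWithin_le_nhds (gt_mem_nhds (by positivity))
      filter_upwards [h1, self_mem_nhdsWithin] with s hs hs0
      rw [Set.mem_Ioi] at hs0
      have ht : 0 < s * W := by positivity
      rw [lt_div_iff₀ hwe] at hs
      refine Eventually.of_forall fun x => ?_
      by_cases hx : x ∈ Set.Ioc ((a - e) / (s * W)) ((b - e) / (s * W))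
      · simp only [F, Set.indicator_of_mem hx, G]
        obtain ⟨hx1, hx2⟩ := hx
        rw [div_lt_iff₀ ht] at hx1
        rw [le_div_iff₀ ht] at hx2
        have hgM := hM (e + s * W * x) ⟨by linarith, by linarith⟩
        have hden : W ^ 2 / 4 * (1 + x ^ 2) ≤ (W * x) ^ 2 + w (e + s * W * x) ^ 2 := by
          by_cases hc : |e + s * W * x - e| < δ
          · have := hδw _ hc
            have : (W / 2) ^ 2 ≤ w (e + s * W * x) ^ 2 := by gcongr
            nlinarith [sq_nonneg (W * x)]
          · rw [add_sub_cancel_left, abs_mul, abs_of_pos ht] at hc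
            have h1 : 1 ≤ |x| := by
              by_contra! h
              nlinarith
            have : 1 ≤ x ^ 2 := by rw [← sq_abs]; nlinarith
            nlinarith [sq_nonneg (w (e + s * W * x)), mul_le_mul_of_nonneg_left this (sq_nonneg W)]
        have hpos : 0 < W ^ 2 / 4 * (1 + x ^ 2) := by positivity
        rw [norm_mul, norm_div, Real.norm_of_nonneg hwe.le,
          Real.norm_of_nonneg (hpos.le.trans hden)]
        calc _ ≤ W * (M / (W ^ 2 / 4 * (1 + x ^ 2))) := by gcongr
          _ = _ := by field_simp
      · simp only [F, Set.indicator_of_notMem hx, norm_zero]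
        positivity
    · exact integrable_inv_one_add_sq.const_mul _
    · refine Eventually.of_forall fun x => ?_
      have hc : Tendsto (fun s : ℝ => e + s * W * x) (nhds 0) (nhds e) := by
        have : Continuous (fun s : ℝ => e + s * W * x) := by fun_prop
        simpa using this.tendsto 0
      have hG : Tendsto (fun s => G s x) (nhds 0) (nhds ((g e / W) * (1 + x ^ 2)⁻¹)) := by
        have h2 : (g e / W) * (1 + x ^ 2)⁻¹ = W * (g e / ((W * x) ^ 2 + W ^ 2)) := by
          have : (W * x) ^ 2 + W ^ 2 = W ^ 2 * (1 + x ^ 2) := by ring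
          rw [this]; field_simp
        rw [h2]
        refine Tendsto.const_mul _ (Tendsto.div ((hg.tendsto e).comp hc) ?_ (by positivity))
        exact (((hw.tendsto e).comp hc).pow 2).const_add _
      refine (hG.mono_left nhdsWithin_le_nhds).congr' ?_
      have h1 := hc.eventually (Ioo_mem_nhds hae heb)
      filter_upwards [nhdsWithin_le_nhds h1, self_mem_nhdsWithin] with s hs hs0
      rw [Set.mem_Ioi] at hs0
      have ht : 0 < s * W := by positivity
      have hs' := hs.1
      have hs'' := hs.2
      have hx : x ∈ Set.Ioc ((a - e) / (s * W)) ((b - e) / (s * W)) := by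
        constructor
        · rw [div_lt_iff₀ ht]; linarith
        · rw [le_div_iff₀ ht]; linarith
      simp only [F, Set.indicator_of_mem hx]
  refine key.congr' ?_
  filter_upwards [self_mem_nhdsWithin] with s hs0
  rw [Set.mem_Ioi] at hs0
  have ht : 0 < s * W := by positivity
  have hle : (a - e) / (s * W) ≤ (b - e) / (s * W) := by gcongr; linarith
  have hsub := intervalIntegral.mul_integral_comp_add_mul (a := (a - e) / (s * W))
    (b := (b - e) / (s * W)) (f := fun E => g E / ((E - e) ^ 2 + s ^ 2 * w E ^ 2)) (s * W) e
  rw [mul_div_cancel₀ _ ht.ne', mul_div_cancel₀ _ ht.ne', add_sub_cancel, add_sub_cancel] at hsub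
  rw [← hsub, integral_indicator measurableSet_Ioc, ← intervalIntegral.integral_of_le hle,
    ← mul_assoc, ← intervalIntegral.integral_const_mul]
  congr 1
  ext x
  simp only [G]
  have : (e + s * W * x - e) ^ 2 + s ^ 2 * w (e + s * W * x) ^ 2
    = s ^ 2 * ((W * x) ^ 2 + w (e + s * W * x) ^ 2) := by ring
  rw [this, ← div_div]
  field_simp
end
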